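/- One-sided uniform deviation bound: for any δ > 0, with probability at least 1 − δ/2 over the draw of the samples S_1, …, S_N, simultaneously for every h ∈ H: ε_α(h) ≤ ε̂_α(h) + 2 Σ_{i=1}^N α_i R_i(H) + 3 √(log(4/δ) M² / 2) · √(Σ_{i=1}^N α_i² / m_i). -/

import Mathlib

open MeasureTheory

noncomputable section

/-- A Rademacher sign encoded by a Boolean. -/
def radSign (b : Bool) : ℝ := if b then 1 else -1

variable {X Y : Type*} [MeasurableSpace X] [MeasurableSpace Y]

/-- Expected risk of a predictor `f` under a distribution `P` on `X × Y`. -/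
def expRisk (L : Y → Y → ℝ) (P : Measure (X × Y)) (f : X → Y) : ℝ :=
  ∫ z, L (f z.1) z.2 ∂P

/-- The α-weighted empirical risk of `f` on the samples `S`. -/
def empRisk {N : ℕ} (L : Y → Y → ℝ) (m : Fin N → ℕ) (α : Fin N → ℝ)
    (S : (i : Fin N) → Fin (m i) → X × Y) (f : X → Y) : ℝ :=
  ∑ i, (α i / (m i : ℝ)) * ∑ j, L (f (S i j).1) (S i j).2

/-- Joint distribution of the samples: for each source `i`, `m i` i.i.d. draws from `D i`,
all sources mutually independent. -/
def sampleMeasure {N : ℕ} (m : Fin N → ℕ) (D : Fin N → Measure (X × Y)) :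
    Measure ((i : Fin N) → Fin (m i) → X × Y) :=
  Measure.pi fun i => Measure.pi fun _ => D i

/-- Joint distribution of the i.i.d. Rademacher signs (encoded as Booleans). -/
def radMeasure (N : ℕ) (m : Fin N → ℕ) : Measure ((i : Fin N) → Fin (m i) → Bool) :=
  Measure.pi fun _ => Measure.pi fun _ => (PMF.uniformOfFintype Bool).toMeasure

/-- Data-dependent Rademacher complexity of source `i`. -/
def radComplexity {ι : Type*} {N : ℕ} (L : Y → Y → ℝ) (h : ι → X → Y) (m : Fin N → ℕ)
    (S : (i : Fin N) → Fin (m i) → X × Y) (i : Fin N) : ℝ :=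
  ∫ σ, (⨆ k, (1 / (m i : ℝ)) * ∑ j, radSign (σ i j) * L (h k (S i j).1) (S i j).2)
    ∂(radMeasure N m)

/-- Discrepancy between two distributions with respect to the hypothesis class `h`. -/
def discrepancy {ι : Type*} (L : Y → Y → ℝ) (h : ι → X → Y) (P Q : Measure (X × Y)) : ℝ :=
  ⨆ k, |expRisk L P (h k) - expRisk L Q (h k)|

/-- Functions that are one-Lipschitz for `d` have sub-Gaussian fluctuations with proxy `v`. -/
def LipSubG {Ω : Type*} [MeasurableSpace Ω] (μ : Measure Ω) (d : Ω → Ω → ℝ) (v : ℝ) : Prop :=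
  ∀ f : Ω → ℝ, Measurable f → (∃ C, ∀ x, |f x| ≤ C) → (∀ x y, f x - f y ≤ d x y) →
    ∀ t : ℝ, ∫ x, Real.exp (t * (f x - ∫ y, f y ∂μ)) ∂μ ≤ Real.exp (v * t ^ 2 / 2)

lemma int_bdd {Ω : Type*} [MeasurableSpace Ω] {μ : Measure Ω} [IsProbabilityMeasure μ]
    {f : Ω → ℝ} (hf : Measurable f) {C : ℝ} (hC : ∀ x, |f x| ≤ C) : Integrable f μ :=
  Integrable.of_bound hf.aestronglyMeasurable C (ae_of_all _ hC)

lemma abs_int_bdd {Ω : Type*} [MeasurableSpace Ω] {μ : Measure Ω} [IsProbabilityMeasure μ]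
    {f : Ω → ℝ} {C : ℝ} (hC : ∀ x, |f x| ≤ C) : |∫ x, f x ∂μ| ≤ C := by
  have := norm_integral_le_of_norm_le_const (μ := μ) (f := f) (C := C) (ae_of_all _ hC)
  simpa using this

lemma int_exp_bdd {Ω : Type*} [MeasurableSpace Ω] {μ : Measure Ω} [IsProbabilityMeasure μ]
    {f : Ω → ℝ} (hf : Measurable f) {C : ℝ} (hC : ∀ x, |f x| ≤ C) (t a : ℝ) :
    Integrable (fun x => Real.exp (t * (f x - a))) μ := by
  refine int_bdd (C := Real.exp (|t| * (C + |a|))) (by fun_prop) fun x => ?_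
  rw [Real.abs_exp]
  apply Real.exp_le_exp.mpr
  refine (le_abs_self _).trans ?_
  rw [abs_mul]
  gcongr
  exact (abs_sub _ _).trans (by gcongr; exact hC x)

open Classical in
lemma LipSubG.base {Ω : Type*} [MeasurableSpace Ω] (μ : Measure Ω) [IsProbabilityMeasure μ]
    (c : ℝ) (hc : 0 ≤ c) :
    LipSubG μ (fun x y => if x = y then 0 else c) (c ^ 2 / 4) := by
  intro f hf ⟨C, hC⟩ hd t
  have hne : Nonempty Ω := nonempty_of_isProbabilityMeasure μ
  have hbd : BddBelow (Set.range f) := ⟨-C, by rintro _ ⟨x, rfl⟩; exact (abs_le.mp (hC x)).1⟩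
  have hd' : ∀ x y, f x - f y ≤ c := fun x y => (hd x y).trans (by
    simp only
    split_ifs <;> simp [hc])
  have h := ProbabilityTheory.hasSubgaussianMGF_of_mem_Icc (μ := μ) (X := f) (a := ⨅ x, f x)
    (b := (⨅ x, f x) + c) hf.aemeasurable (ae_of_all _ fun x => ⟨ciInf_le hbd x, by
      have : f x - c ≤ ⨅ y, f y := le_ciInf fun y => by linarith [hd' x y]
      linarith⟩)
  have := h.mgf_le t
  simp only [ProbabilityTheory.mgf] at this
  refine this.trans (le_of_eq ?_)
  congr 1
  have h0 : (⨅ x, f x) + c - (⨅ x, f x) = c := by ring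
  rw [h0]
  push_cast
  rw [Real.norm_eq_abs, abs_of_nonneg hc]
  ring

lemma LipSubG.prod {A B : Type*} [MeasurableSpace A] [MeasurableSpace B] {μ : Measure A}
    {ν : Measure B} [IsProbabilityMeasure μ] [IsProbabilityMeasure ν] {d : A → A → ℝ}
    {e : B → B → ℝ} {v w : ℝ} (hd : ∀ x, d x x = 0) (he : ∀ x, e x x = 0)
    (h1 : LipSubG μ d v) (h2 : LipSubG ν e w) :
    LipSubG (μ.prod ν) (fun p q => d p.1 q.1 + e p.2 q.2) (v + w) := by
  intro f hf ⟨C, hC⟩ hL t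
  set g : A → ℝ := fun x => ∫ y, f (x, y) ∂ν with hg
  have hfx : ∀ x, Measurable fun y => f (x, y) := fun x => hf.comp measurable_prodMk_left
  have hgm : Measurable g :=
    (StronglyMeasurable.integral_prod_right (f := fun x y => f (x, y))
      hf.stronglyMeasurable).measurable
  have hgC : ∀ x, |g x| ≤ C := fun x => abs_int_bdd fun y => hC _
  have hgd : ∀ x y, g x - g y ≤ d x y := by
    intro x y
    rw [hg]
    simp only
    rw [← integral_sub (int_bdd (hfx x) fun z => hC _) (int_bdd (hfx y) fun z => hC _)]
    calc _ ≤ ∫ _, d x y ∂ν := by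
          apply integral_mono
          · exact (int_bdd (hfx x) fun z => hC _).sub (int_bdd (hfx y) fun z => hC _)
          · exact integrable_const _
          · intro z
            have := hL (x, z) (y, z)
            simpa [he] using this
      _ = _ := by simp
  have hE : ∫ z, f z ∂(μ.prod ν) = ∫ x, g x ∂μ := integral_prod f (int_bdd hf hC)
  rw [hE]
  set a := ∫ x, g x ∂μ with ha
  rw [integral_prod _ (int_exp_bdd hf hC t a)]
  have hin : ∀ x, ∫ y, Real.exp (t * (f (x, y) - a)) ∂ν ≤
      Real.exp (t * (g x - a)) * Real.exp (w * t ^ 2 / 2) := by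
    intro x
    have h := h2 (fun y => f (x, y)) (hfx x) ⟨C, fun y => hC _⟩ (fun y z => by
      have := hL (x, y) (x, z)
      simpa [hd] using this) t
    have : (fun y => Real.exp (t * (f (x, y) - a))) =
        fun y => Real.exp (t * (g x - a)) * Real.exp (t * (f (x, y) - g x)) := by
      funext y
      rw [← Real.exp_add]; congr 1; ring
    rw [this, integral_const_mul]
    gcongr
  calc _ ≤ ∫ x, Real.exp (t * (g x - a)) * Real.exp (w * t ^ 2 / 2) ∂μ := by
        apply integral_mono (int_exp_bdd hf hC t a).integral_prod_left
          ((int_exp_bdd hgm hgC t a).mul_const _) hin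
    _ = (∫ x, Real.exp (t * (g x - a)) ∂μ) * Real.exp (w * t ^ 2 / 2) := integral_mul_const _ _
    _ ≤ Real.exp (v * t ^ 2 / 2) * Real.exp (w * t ^ 2 / 2) := by
        gcongr
        exact h1 g hgm ⟨C, hgC⟩ hgd t
    _ = _ := by rw [← Real.exp_add]; congr 1; ring

lemma LipSubG.pi : ∀ {n : ℕ} {Ω : Fin n → Type*} [∀ i, MeasurableSpace (Ω i)]
    (μ : ∀ i, Measure (Ω i)) [∀ i, IsProbabilityMeasure (μ i)] (d : ∀ i, Ω i → Ω i → ℝ)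
    (v : Fin n → ℝ) (_ : ∀ i x, d i x x = 0) (_ : ∀ i, LipSubG (μ i) (d i) (v i)),
    LipSubG (Measure.pi μ) (fun x y => ∑ i, d i (x i) (y i)) (∑ i, v i) := by
  intro n
  induction n with
  | zero =>
    intro Ω _ μ _ d v hd h f hf hC hL t
    have : ∀ x, f x = f (fun i => i.elim0) := fun x => by
      congr 1; funext i; exact i.elim0
    have h2 : (fun x => f x) = fun _ => f (fun i => i.elim0) := funext this
    simp [this]
  | succ n ih =>
    intro Ω _ μ _ d v hd h f hf hC hL t
    have hp := LipSubG.prod (hd 0) (fun x => by simp [hd]) (h 0)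
      (ih (fun i => μ i.succ) (fun i => d i.succ) (fun i => v i.succ) (fun i => hd i.succ)
        (fun i => h i.succ))
    have mp := measurePreserving_piFinSuccAbove μ 0
    set E := MeasurableEquiv.piFinSuccAbove Ω 0 with hEdef
    obtain ⟨C, hC⟩ := hC
    have hE1 : ∀ p, (E.symm p) 0 = p.1 := fun p => rfl
    have hE2 : ∀ p (i : Fin n), (E.symm p) i.succ = p.2 i := fun p i => rfl
    have := hp (fun p => f (E.symm p)) (hf.comp E.symm.measurable) ⟨C, fun p => hC _⟩
      (fun p q => by
        have := hL (E.symm p) (E.symm q)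
        simp only at this
        rw [Fin.sum_univ_succ] at this
        exact this) t
    have e1 := mp.integral_comp' (g := fun p => f (E.symm p))
    simp only [MeasurableEquiv.symm_apply_apply] at e1
    have e2 := mp.integral_comp' (g := fun p =>
      Real.exp (t * (f (E.symm p) - ∫ x, f x ∂(Measure.pi μ))))
    simp only [MeasurableEquiv.symm_apply_apply] at e2
    rw [e2, Fin.sum_univ_succ, e1]
    exact this

lemma LipSubG.tail {Ω : Type*} [MeasurableSpace Ω] {μ : Measure Ω} [IsProbabilityMeasure μ]
    {d : Ω → Ω → ℝ} {v : ℝ} (hv : 0 ≤ v) (h : LipSubG μ d v) (f : Ω → ℝ) (hf : Measurable f)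
    {C : ℝ} (hC : ∀ x, |f x| ≤ C) (hL : ∀ x y, f x - f y ≤ d x y) {ε : ℝ} (hε : 0 ≤ ε) :
    μ.real {x | ε ≤ f x - ∫ y, f y ∂μ} ≤ Real.exp (-ε ^ 2 / (2 * v)) := by
  have : ProbabilityTheory.HasSubgaussianMGF (fun x => f x - ∫ y, f y ∂μ) ⟨v, hv⟩ μ :=
    ⟨fun t => int_exp_bdd hf hC t _, fun t => h f hf ⟨C, hC⟩ hL t⟩
  exact this.measure_ge_le hε

lemma mp_int {A B : Type*} [MeasurableSpace A] [MeasurableSpace B] {μ : Measure A}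
    {ν : Measure B} {φ : A → B} (h : MeasurePreserving φ μ ν) {g : B → ℝ} (hg : Measurable g) :
    ∫ x, g (φ x) ∂μ = ∫ y, g y ∂ν := by
  rw [← h.map_eq, integral_map h.measurable.aemeasurable hg.aestronglyMeasurable]

lemma bddA {ι : Type*} {f : ι → ℝ} {C : ℝ} (h : ∀ k, |f k| ≤ C) : BddAbove (Set.range f) :=
  ⟨C, by rintro _ ⟨k, rfl⟩; exact (abs_le.mp (h k)).2⟩

lemma abs_sup_le {ι : Type*} [Nonempty ι] {f : ι → ℝ} {C : ℝ} (h : ∀ k, |f k| ≤ C) :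
    |⨆ k, f k| ≤ C := by
  rw [abs_le]
  obtain ⟨k⟩ := ‹Nonempty ι›
  exact ⟨(abs_le.mp (h k)).1.trans (le_ciSup (bddA h) k), 
    haveI : Nonempty ι := ⟨k⟩
    ciSup_le fun k => (abs_le.mp (h k)).2⟩

lemma sup_sub_le {ι : Type*} [Nonempty ι] {f g : ι → ℝ} {C c : ℝ} (hg : ∀ k, |g k| ≤ C)
    (h : ∀ k, f k - g k ≤ c) : (⨆ k, f k) - (⨆ k, g k) ≤ c := by
  rw [sub_le_iff_le_add]
  exact ciSup_le fun k => by linarith [h k, le_ciSup (bddA hg) k]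

lemma avg_le {n : ℕ} {a : Fin n → ℝ} {C : ℝ} (hC : 0 ≤ C) (h : ∀ j, |a j| ≤ C) :
    |(1 / (n : ℝ)) * ∑ j, a j| ≤ C := by
  rcases Nat.eq_zero_or_pos n with rfl | hn
  · simpa using hC
  have hn' : (0 : ℝ) < n := by exact_mod_cast hn
  rw [abs_mul, abs_of_nonneg (by positivity), one_div, inv_mul_le_iff₀ hn']
  refine (Finset.abs_sum_le_sum_abs _ _).trans ?_
  calc _ ≤ ∑ _j : Fin n, C := Finset.sum_le_sum fun j _ => h j
    _ = _ := by simp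

lemma abs_radSign (b : Bool) : |radSign b| = 1 := by cases b <;> simp [radSign]

lemma radSign_not (b : Bool) : radSign (!b) = - radSign b := by cases b <;> simp [radSign]

lemma measurable_radSign : Measurable radSign := measurable_of_finite _

set_option linter.unusedSectionVars false

section symm

variable {ι Z : Type*} [Countable ι] [Nonempty ι] [MeasurableSpace Z]

/-- The Rademacher supremum for a fixed sign vector. -/
def radSup (l : ι → Z → ℝ) {n : ℕ} (s : Fin n → Bool) (T : Fin n → Z) : ℝ :=
  ⨆ k, (1 / (n : ℝ)) * ∑ j, radSign (s j) * l k (T j)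

lemma radSup_meas {l : ι → Z → ℝ} (hl : ∀ k, Measurable (l k)) {n : ℕ} :
    Measurable fun p : (Fin n → Z) × (Fin n → Bool) => radSup l p.2 p.1 := by
  unfold radSup
  refine Measurable.iSup fun k => Measurable.const_mul (Finset.measurable_fun_sum _ fun j _ => ?_) _
  exact (measurable_radSign.comp (by fun_prop)).mul ((hl k).comp (by fun_prop))

lemma radSup_bdd {l : ι → Z → ℝ} {M : ℝ} (hM : 0 ≤ M) (hl : ∀ k z, |l k z| ≤ M) {n : ℕ}
    (s : Fin n → Bool) (T : Fin n → Z) : |radSup l s T| ≤ M :=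
  abs_sup_le fun k => avg_le hM fun j => by rw [abs_mul, abs_radSign, one_mul]; exact hl _ _

lemma le_radSup {l : ι → Z → ℝ} {M : ℝ} (hM : 0 ≤ M) (hl : ∀ k z, |l k z| ≤ M) {n : ℕ}
    (s : Fin n → Bool) (T : Fin n → Z) (k : ι) :
    (1 / (n : ℝ)) * ∑ j, radSign (s j) * l k (T j) ≤ radSup l s T :=
  le_ciSup (f := fun k => (1 / (n : ℝ)) * ∑ j, radSign (s j) * l k (T j))
    (bddA (C := M) fun k => avg_le hM fun j => by
      rw [abs_mul, abs_radSign, one_mul]; exact hl k (T j)) k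

/-- Uniform measure on sign vectors. -/
def signMeas (n : ℕ) : Measure (Fin n → Bool) :=
  Measure.pi fun _ => (PMF.uniformOfFintype Bool).toMeasure

instance (n : ℕ) : IsProbabilityMeasure (signMeas n) := by unfold signMeas; infer_instance

lemma not_mp : MeasurePreserving (fun b : Bool => !b) (PMF.uniformOfFintype Bool).toMeasure
    (PMF.uniformOfFintype Bool).toMeasure := by
  refine ⟨measurable_of_finite _, ?_⟩
  refine Measure.ext_of_singleton fun b => ?_
  rw [Measure.map_apply (measurable_of_finite _) (measurableSet_singleton _)]
  have : (fun b : Bool => !b) ⁻¹' {b} = {!b} := by ext x; cases x <;> cases b <;> simp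
  rw [this, PMF.toMeasure_apply_singleton _ _ (measurableSet_singleton _),
    PMF.toMeasure_apply_singleton _ _ (measurableSet_singleton _)]
  simp

lemma signMeas_not (n : ℕ) : MeasurePreserving (fun (s : Fin n → Bool) j => !(s j))
    (signMeas n) (signMeas n) :=
  measurePreserving_pi _ _ fun _ => not_mp

/-- Two-sample supremum. -/
def twoSup (l : ι → Z → ℝ) {n : ℕ} (T T' : Fin n → Z) : ℝ :=
  ⨆ k, (1 / (n : ℝ)) * ∑ j, (l k (T' j) - l k (T j))

lemma twoSup_meas {l : ι → Z → ℝ} (hl : ∀ k, Measurable (l k)) {n : ℕ} :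
    Measurable fun p : (Fin n → Z) × (Fin n → Z) => twoSup l p.1 p.2 := by
  unfold twoSup
  refine Measurable.iSup fun k => Measurable.const_mul (Finset.measurable_fun_sum _ fun j _ => ?_) _
  exact ((hl k).comp (by fun_prop)).sub ((hl k).comp (by fun_prop))

lemma two_bdd {l : ι → Z → ℝ} {M : ℝ} (hM : 0 ≤ M) (hl : ∀ k z, |l k z| ≤ M) {n : ℕ}
    (T T' : Fin n → Z) (k : ι) : |(1 / (n : ℝ)) * ∑ j, (l k (T' j) - l k (T j))| ≤ 2 * M :=
  avg_le (by linarith) fun j => (abs_sub _ _).trans (by linarith [hl k (T' j), hl k (T j)])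

lemma le_twoSup {l : ι → Z → ℝ} {M : ℝ} (hM : 0 ≤ M) (hl : ∀ k z, |l k z| ≤ M) {n : ℕ}
    (T T' : Fin n → Z) (k : ι) :
    (1 / (n : ℝ)) * ∑ j, (l k (T' j) - l k (T j)) ≤ twoSup l T T' :=
  le_ciSup (f := fun k => (1 / (n : ℝ)) * ∑ j, (l k (T' j) - l k (T j)))
    (bddA fun k => two_bdd hM hl T T' k) k

lemma twoSup_bdd {l : ι → Z → ℝ} {M : ℝ} (hM : 0 ≤ M) (hl : ∀ k z, |l k z| ≤ M) {n : ℕ}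
    (T T' : Fin n → Z) : |twoSup l T T'| ≤ 2 * M :=
  abs_sup_le fun k => two_bdd hM hl T T' k

lemma twoSup_le {l : ι → Z → ℝ} {n : ℕ} {T T' : Fin n → Z} {c : ℝ}
    (h : ∀ k, (1 / (n : ℝ)) * ∑ j, (l k (T' j) - l k (T j)) ≤ c) : twoSup l T T' ≤ c :=
  ciSup_le h

attribute [irreducible] radSup twoSup signMeas

set_option maxHeartbeats 1000000 in
lemma symmetrization {l : ι → Z → ℝ} (hlm : ∀ k, Measurable (l k)) {M : ℝ} (hM : 0 ≤ M)
    (hl : ∀ k z, |l k z| ≤ M) {n : ℕ} (hn : 1 ≤ n) (D : Measure Z) [IsProbabilityMeasure D] :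
    ∫ T, (⨆ k, ((∫ z, l k z ∂D) - (1 / (n : ℝ)) * ∑ j, l k (T j))) ∂(Measure.pi fun _ : Fin n => D)
      ≤ 2 * ∫ T, ∫ s, radSup l s T ∂(signMeas n) ∂(Measure.pi fun _ : Fin n => D) := by
  have hn' : (0 : ℝ) < n := by exact_mod_cast hn
  obtain ⟨P, hP⟩ : ∃ P, P = Measure.pi fun _ : Fin n => D := ⟨_, rfl⟩
  obtain ⟨Q, hQ⟩ : ∃ Q, Q = Measure.pi fun _ : Fin n => D.prod D := ⟨_, rfl⟩
  rw [← hP]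
  have instP : IsProbabilityMeasure P := by rw [hP]; infer_instance
  have instQ : IsProbabilityMeasure Q := by rw [hQ]; infer_instance
  have mpe : ∀ j, MeasurePreserving (fun T : Fin n → Z => T j) P D := fun j => by
    rw [hP]; exact measurePreserving_eval (fun _ : Fin n => D) j
  have mpa : MeasurePreserving (fun W : Fin n → Z × Z => (fun j => (W j).1, fun j => (W j).2)) Q
      (P.prod P) := by
    rw [hP, hQ]
    exact measurePreserving_arrowProdEquivProdArrow Z Z (Fin n) (fun _ => D) fun _ => D
  have tb : ∀ T T' : Fin n → Z, |twoSup l T T'| ≤ 2 * M := twoSup_bdd hM hl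
  -- step 1
  have s1 : ∀ T, (⨆ k, ((∫ z, l k z ∂D) - (1 / (n : ℝ)) * ∑ j, l k (T j))) ≤
      ∫ T', twoSup l T T' ∂P := by
    intro T
    refine ciSup_le fun k => ?_
    have hi : ∀ j : Fin n, Integrable (fun T' : Fin n → Z => l k (T' j)) P := fun j =>
      int_bdd ((hlm k).comp (measurable_pi_apply j)) fun T' => hl _ _
    have hi2 : ∀ j : Fin n, Integrable (fun T' : Fin n → Z => l k (T' j) - l k (T j)) P :=
      fun j => (hi j).sub (integrable_const _)
    have : (∫ z, l k z ∂D) - (1 / (n : ℝ)) * ∑ j, l k (T j) =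
        ∫ T', (1 / (n : ℝ)) * ∑ j, (l k (T' j) - l k (T j)) ∂P := by
      rw [integral_const_mul, integral_finsetSum _ fun j _ => hi2 j]
      have : ∀ j : Fin n, ∫ T', (l k (T' j) - l k (T j)) ∂P = (∫ z, l k z ∂D) - l k (T j) := by
        intro j
        rw [integral_sub (hi j) (integrable_const _)]
        rw [mp_int (mpe j) (hlm k)]
        simp
      simp only [this, Finset.sum_sub_distrib]
      simp
      field_simp
    rw [this]
    have tmT : Measurable fun T' => twoSup l T T' :=
      (twoSup_meas hlm).comp (measurable_prodMk_left (x := T))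
    have am : Measurable fun T' : Fin n → Z => (1 / (n : ℝ)) * ∑ j, (l k (T' j) - l k (T j)) := by
      exact Measurable.const_mul (Finset.measurable_fun_sum _ fun j _ =>
        ((hlm k).comp (measurable_pi_apply j)).sub measurable_const) _
    have i1 := int_bdd (μ := P) am fun T' => two_bdd hM hl T T' k
    have i2 := int_bdd (μ := P) tmT (tb T)
    refine integral_mono i1 i2 fun T' => ?_
    exact le_twoSup hM hl T T' k
  have mp1 : MeasurePreserving (fun (W : Fin n → Z × Z) j => (W j).1) Q P := by
    rw [hP, hQ]
    exact measurePreserving_pi _ _ fun _ => measurePreserving_fst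
  have mp2 : MeasurePreserving (fun (W : Fin n → Z × Z) j => (W j).2) Q P := by
    rw [hP, hQ]
    exact measurePreserving_pi _ _ fun _ => measurePreserving_snd
  have ti : Integrable (fun p : (Fin n → Z) × (Fin n → Z) => twoSup l p.1 p.2) (P.prod P) :=
    int_bdd (twoSup_meas hlm) fun p => tb _ _
  have s2 : ∫ T, ∫ T', twoSup l T T' ∂P ∂P =
      ∫ W, twoSup l (fun j => (W j).1) (fun j => (W j).2) ∂Q := by
    rw [← integral_prod (fun p : (Fin n → Z) × (Fin n → Z) => twoSup l p.1 p.2) ti]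
    exact (mp_int mpa (twoSup_meas hlm)).symm
  have rm : ∀ s : Fin n → Bool, Measurable fun T => radSup l s T := fun s =>
    (radSup_meas hlm).comp (measurable_prodMk_right (y := s))
  have s3 : ∀ s : Fin n → Bool, ∫ W, twoSup l (fun j => (W j).1) (fun j => (W j).2) ∂Q ≤
      (∫ T, radSup l s T ∂P) + ∫ T, radSup l (fun j => !(s j)) T ∂P := by
    intro s
    have msw : MeasurePreserving (fun (W : Fin n → Z × Z) j =>
        (if s j then id else Prod.swap : Z × Z → Z × Z) (W j)) Q Q := by
      rw [hQ]
      refine measurePreserving_pi _ _ fun j => ?_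
      cases s j
      · simpa using Measure.measurePreserving_swap
      · simpa using MeasurePreserving.id _
    have tm : Measurable fun W : Fin n → Z × Z =>
        twoSup l (fun j => (W j).1) (fun j => (W j).2) :=
      (twoSup_meas hlm).comp (mp1.measurable.prodMk mp2.measurable)
    rw [← mp_int msw tm, ← mp_int mp2 (rm s), ← mp_int mp1 (rm _)]
    have i2 : Integrable (fun W : Fin n → Z × Z => radSup l s fun j => (W j).2) Q :=
      int_bdd ((rm s).comp mp2.measurable) fun W => radSup_bdd hM hl _ _
    have i1 : Integrable (fun W : Fin n → Z × Z => radSup l (fun j => !(s j)) fun j => (W j).1) Q :=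
      int_bdd ((rm _).comp mp1.measurable) fun W => radSup_bdd hM hl _ _
    rw [← integral_add i2 i1]
    refine integral_mono (int_bdd (tm.comp msw.measurable) fun W => tb _ _) (i2.add i1) fun W => ?_
    refine twoSup_le fun k => ?_
    have b : ∀ (s : Fin n → Bool) (T : Fin n → Z),
        (1 / (n : ℝ)) * ∑ j, radSign (s j) * l k (T j) ≤ radSup l s T := fun s T =>
      le_radSup hM hl s T k
    refine le_trans (le_of_eq ?_) (add_le_add (b _ _) (b _ _))
    rw [← mul_add, ← Finset.sum_add_distrib]
    congr 1
    refine Finset.sum_congr rfl fun j _ => ?_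
    cases hs : s j <;> simp [hs, radSign] <;> ring
  have am : Measurable fun s => ∫ T, radSup l s T ∂P := measurable_of_finite _
  have ab : ∀ s, |∫ T, radSup l s T ∂P| ≤ M := fun s => abs_int_bdd fun T => radSup_bdd hM hl _ _
  have ai := int_bdd (μ := signMeas n) am ab
  have ai' : Integrable (fun s : Fin n → Bool => ∫ T, radSup l (fun j => !(s j)) T ∂P)
      (signMeas n) := int_bdd (measurable_of_finite _) fun s => ab _
  have s4 : ∫ W, twoSup l (fun j => (W j).1) (fun j => (W j).2) ∂Q ≤
      2 * ∫ s, ∫ T, radSup l s T ∂P ∂(signMeas n) := by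
    calc _ = ∫ _s, (∫ W, twoSup l (fun j => (W j).1) (fun j => (W j).2) ∂Q) ∂(signMeas n) := by
          simp
      _ ≤ ∫ s, ((∫ T, radSup l s T ∂P) + ∫ T, radSup l (fun j => !(s j)) T ∂P) ∂(signMeas n) :=
          integral_mono (integrable_const _) (ai.add ai') s3
      _ = _ := by
          rw [integral_add ai ai', mp_int (signMeas_not n) am]; ring
  have s5 : ∫ s, ∫ T, radSup l s T ∂P ∂(signMeas n) = ∫ T, ∫ s, radSup l s T ∂(signMeas n) ∂P := by
    have hm2 : Measurable (Function.uncurry fun (s : Fin n → Bool) (T : Fin n → Z) =>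
      radSup l s T) := (radSup_meas hlm).comp measurable_swap
    exact integral_integral_swap (int_bdd (C := M) hm2 fun p => radSup_bdd hM hl p.1 p.2)
  rw [← s5]
  rw [← s2] at s4
  refine le_trans ?_ s4
  refine integral_mono (int_bdd (C := 2 * M) ?_ fun T => abs_sup_le fun k => ?_)
    ti.integral_prod_left s1
  · exact Measurable.iSup fun k => measurable_const.sub (Measurable.const_mul
      (Finset.measurable_fun_sum _ fun j _ => (hlm k).comp (measurable_pi_apply j)) _)
  · refine (abs_sub _ _).trans ?_
    have h1 : |∫ z, l k z ∂D| ≤ M := abs_int_bdd (hl k)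
    have h2 := avg_le (a := fun j => l k (T j)) hM fun j => hl _ _
    linarith

end symm

/-- Rademacher complexity as a function of one sample. -/
def rc {ι Z : Type*} [MeasurableSpace Z] (l : ι → Z → ℝ) {n : ℕ} (T : Fin n → Z) : ℝ :=
  ∫ s, radSup l s T ∂(signMeas n)

lemma radComplexity_eq {ι : Type*} {N : ℕ} (L : Y → Y → ℝ) (h : ι → X → Y) (m : Fin N → ℕ)
    (S : (i : Fin N) → Fin (m i) → X × Y) (i : Fin N) :
    radComplexity L h m S i = rc (fun k (z : X × Y) => L (h k z.1) z.2) (S i) := by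
  unfold rc radSup signMeas radComplexity radMeasure
  have mp := measurePreserving_eval
    (fun i : Fin N => Measure.pi fun _ : Fin (m i) => (PMF.uniformOfFintype Bool).toMeasure) i
  exact mp_int mp (g := fun s => ⨆ k, (1 / (m i : ℝ)) *
    ∑ j, radSign (s j) * L (h k (S i j).1) (S i j).2) (measurable_of_finite _)

lemma rc_meas {ι Z : Type*} [Countable ι] [Nonempty ι] [MeasurableSpace Z] {l : ι → Z → ℝ}
    (hl : ∀ k, Measurable (l k)) {n : ℕ} : Measurable fun T : Fin n → Z => rc l T := by
  unfold rc
  exact (StronglyMeasurable.integral_prod_right (f := fun T s => radSup l s T)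
    (radSup_meas hl).stronglyMeasurable).measurable

lemma rc_bdd {ι Z : Type*} [Countable ι] [Nonempty ι] [MeasurableSpace Z] {l : ι → Z → ℝ} {M : ℝ}
    (hM : 0 ≤ M) (hl : ∀ k z, |l k z| ≤ M) {n : ℕ} (T : Fin n → Z) : |rc l T| ≤ M :=
  abs_int_bdd fun s => radSup_bdd hM hl s T

open Classical in
lemma rc_lip {ι Z : Type*} [Countable ι] [Nonempty ι] [MeasurableSpace Z] {l : ι → Z → ℝ} {M : ℝ}
    (hM : 0 ≤ M) (hl : ∀ k z, |l k z| ≤ M) (hd : ∀ k z z', l k z - l k z' ≤ M) {n : ℕ}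
    (T T' : Fin n → Z) :
    rc l T - rc l T' ≤ (1 / (n : ℝ)) * ∑ j, if T j = T' j then 0 else M := by
  have hi : ∀ T : Fin n → Z, Integrable (fun s => radSup l s T) (signMeas n) := fun T =>
    int_bdd (measurable_of_finite _) fun s => radSup_bdd hM hl s T
  unfold rc
  rw [← integral_sub (hi T) (hi T')]
  have : ∀ s, radSup l s T - radSup l s T' ≤
      (1 / (n : ℝ)) * ∑ j, if T j = T' j then 0 else M := by
    intro s
    unfold radSup
    refine sup_sub_le (C := M) (fun k => avg_le hM fun j => by
      rw [abs_mul, abs_radSign, one_mul]; exact hl k _) fun k => ?_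
    rw [← mul_sub, ← Finset.sum_sub_distrib]
    refine mul_le_mul_of_nonneg_left (Finset.sum_le_sum fun j _ => ?_) (by positivity)
    split_ifs with hj
    · simp [hj]
    · have h1 := hd k (T j) (T' j)
      have h2 := hd k (T' j) (T j)
      cases s j <;> simp [radSign] <;> linarith
  calc _ ≤ ∫ _s, (1 / (n : ℝ)) * ∑ j, (if T j = T' j then 0 else M) ∂(signMeas n) :=
        integral_mono ((hi T).sub (hi T')) (integrable_const _) this
    _ = _ := by simp

attribute [irreducible] rc

lemma wsum_le {N : ℕ} {α : Fin N → ℝ} (hα : ∀ i, 0 ≤ α i) (hαs : ∑ i, α i = 1) {a : Fin N → ℝ}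
    {C : ℝ} (h : ∀ i, |a i| ≤ C) : |∑ i, α i * a i| ≤ C := by
  refine (Finset.abs_sum_le_sum_abs _ _).trans ?_
  calc _ ≤ ∑ i, α i * C := Finset.sum_le_sum fun i _ => by
        rw [abs_mul, abs_of_nonneg (hα i)]
        exact mul_le_mul_of_nonneg_left (h i) (hα i)
    _ = C := by rw [← Finset.sum_mul, hαs, one_mul]

section main

variable {ι Z : Type*} [Countable ι] [Nonempty ι] [MeasurableSpace Z]

/-- Single-source deviation. -/
def dev (l : ι → Z → ℝ) (D : Measure Z) {n : ℕ} (k : ι) (T : Fin n → Z) : ℝ :=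
  (∫ z, l k z ∂D) - (1 / (n : ℝ)) * ∑ j, l k (T j)

lemma dev_bdd {l : ι → Z → ℝ} {M : ℝ} (hM : 0 ≤ M) (hl : ∀ k z, |l k z| ≤ M) (D : Measure Z)
    [IsProbabilityMeasure D] {n : ℕ} (k : ι) (T : Fin n → Z) : |dev l D k T| ≤ 2 * M := by
  refine (abs_sub _ _).trans ?_
  have h1 : |∫ z, l k z ∂D| ≤ M := abs_int_bdd (hl k)
  have h2 := avg_le (a := fun j => l k (T j)) hM fun j => hl _ _
  linarith

lemma dev_meas {l : ι → Z → ℝ} (hlm : ∀ k, Measurable (l k)) (D : Measure Z) {n : ℕ} (k : ι) :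
    Measurable fun T : Fin n → Z => dev l D k T :=
  measurable_const.sub (Measurable.const_mul
      (Finset.measurable_fun_sum _ fun j _ => (hlm k).comp (measurable_pi_apply j)) _)

open Classical in
lemma dev_lip {l : ι → Z → ℝ} {M : ℝ} (hd : ∀ k z z', l k z - l k z' ≤ M) (D : Measure Z)
    {n : ℕ} (k : ι) (T T' : Fin n → Z) :
    dev l D k T - dev l D k T' ≤ (1 / (n : ℝ)) * ∑ j, if T j = T' j then 0 else M := by
  unfold dev
  rw [sub_sub_sub_cancel_left, ← mul_sub, ← Finset.sum_sub_distrib]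
  refine mul_le_mul_of_nonneg_left (Finset.sum_le_sum fun j _ => ?_) (by positivity)
  split_ifs with hj
  · simp [hj]
  · exact hd k _ _

lemma symm_dev {l : ι → Z → ℝ} (hlm : ∀ k, Measurable (l k)) {M : ℝ} (hM : 0 ≤ M)
    (hl : ∀ k z, |l k z| ≤ M) {n : ℕ} (hn : 1 ≤ n) (D : Measure Z) [IsProbabilityMeasure D] :
    ∫ T, (⨆ k, dev l D k T) ∂(Measure.pi fun _ : Fin n => D)
      ≤ 2 * ∫ T, rc l T ∂(Measure.pi fun _ : Fin n => D) := by
  have := symmetrization hlm hM hl hn D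
  unfold dev rc
  exact this

attribute [irreducible] dev

set_option maxHeartbeats 1000000 in
open Classical in
lemma core {l : ι → Z → ℝ} (hlm : ∀ k, Measurable (l k)) {M : ℝ} (hM : 0 < M)
    (hl0 : ∀ k z, 0 ≤ l k z) (hlM : ∀ k z, l k z ≤ M) {N : ℕ} (D : Fin N → Measure Z)
    [∀ i, IsProbabilityMeasure (D i)] (m : Fin N → ℕ) (hm : ∀ i, 1 ≤ m i)
    (α : Fin N → ℝ) (hα : ∀ i, 0 ≤ α i) (hαs : ∑ i, α i = 1)
    (μ : Measure ((i : Fin N) → Fin (m i) → Z))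
    (hμ : μ = Measure.pi fun i => Measure.pi fun _ => D i) (t : ℝ) (ht : 0 ≤ t) :
    μ.real {S | t ≤ (⨆ k, ∑ i, α i * dev l (D i) k (S i)) - 2 * ∑ i, α i * rc l (S i)} ≤
      Real.exp (-t ^ 2 / (2 * ∑ i, ∑ _j : Fin (m i), (3 * α i * M / m i) ^ 2 / 4)) := by
  have instμ : IsProbabilityMeasure μ := by rw [hμ]; infer_instance
  have hl : ∀ k z, |l k z| ≤ M := fun k z => by
    rw [abs_of_nonneg (hl0 k z)]; exact hlM k z
  have hd : ∀ k z z', l k z - l k z' ≤ M := fun k z z' => by linarith [hl0 k z', hlM k z]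
  have mpe : ∀ i, MeasurePreserving (fun S : (i : Fin N) → Fin (m i) → Z => S i) μ
      (Measure.pi fun _ => D i) := fun i => by
    rw [hμ]; exact measurePreserving_eval (fun i => Measure.pi fun _ : Fin (m i) => D i) i
  have hφb : ∀ (S : (i : Fin N) → Fin (m i) → Z) k, |∑ i, α i * dev l (D i) k (S i)| ≤ 2 * M :=
    fun S k => wsum_le hα hαs fun i => dev_bdd hM.le hl (D i) k (S i)
  obtain ⟨Φ, hΦ⟩ : ∃ Φ : ((i : Fin N) → Fin (m i) → Z) → ℝ,
    ∀ S, Φ S = ⨆ k, ∑ i, α i * dev l (D i) k (S i) := ⟨_, fun _ => rfl⟩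
  obtain ⟨R, hR⟩ : ∃ R : ((i : Fin N) → Fin (m i) → Z) → ℝ,
    ∀ S, R S = ∑ i, α i * rc l (S i) := ⟨_, fun _ => rfl⟩
  have hΦm : Measurable Φ := by
    rw [funext hΦ]
    exact Measurable.iSup fun k => Finset.measurable_fun_sum _ fun i _ =>
      Measurable.const_mul ((dev_meas hlm (D i) k).comp (mpe i).measurable) _
  have hRm : Measurable R := by
    rw [funext hR]
    exact Finset.measurable_fun_sum _ fun i _ =>
      Measurable.const_mul ((rc_meas hlm).comp (mpe i).measurable) _
  have hΦb : ∀ S, |Φ S| ≤ 2 * M := fun S => by rw [hΦ]; exact abs_sup_le (hφb S)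
  have hRb : ∀ S, |R S| ≤ M := fun S => by
    rw [hR]; exact wsum_le hα hαs fun i => rc_bdd hM.le hl (S i)
  have hGm : Measurable fun S => Φ S - 2 * R S := hΦm.sub (hRm.const_mul 2)
  have hGb : ∀ S, |Φ S - 2 * R S| ≤ 4 * M := fun S => by
    refine (abs_sub _ _).trans ?_
    rw [abs_mul, abs_two]
    linarith [hΦb S, hRb S]
  have hΦi : Integrable Φ μ := int_bdd hΦm hΦb
  have hRi : Integrable R μ := int_bdd hRm hRb
  -- the mean is nonpositive
  have hrm : ∀ i, Measurable fun T : Fin (m i) → Z => ⨆ k, dev l (D i) k T := fun i =>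
    Measurable.iSup fun k => dev_meas hlm (D i) k
  have hrb : ∀ i (T : Fin (m i) → Z), |⨆ k, dev l (D i) k T| ≤ 2 * M := fun i T =>
    abs_sup_le fun k => dev_bdd hM.le hl (D i) k T
  have hri : ∀ i, Integrable (fun S : (i : Fin N) → Fin (m i) → Z =>
      α i * ⨆ k, dev l (D i) k (S i)) μ := fun i =>
    (int_bdd ((hrm i).comp (mpe i).measurable) fun S => hrb i (S i)).const_mul _
  have hci : ∀ i, Integrable (fun S : (i : Fin N) → Fin (m i) → Z => α i * rc l (S i)) μ :=
    fun i => (int_bdd ((rc_meas hlm).comp (mpe i).measurable)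
      fun S => rc_bdd hM.le hl (S i)).const_mul _
  have hmean : ∫ S, (Φ S - 2 * R S) ∂μ ≤ 0 := by
    rw [integral_sub hΦi (hRi.const_mul 2), integral_const_mul]
    have h1 : ∫ S, Φ S ∂μ ≤ ∫ S, ∑ i, α i * ⨆ k, dev l (D i) k (S i) ∂μ := by
      refine integral_mono hΦi (integrable_finsetSum _ fun i _ => hri i) fun S => ?_
      simp only [hΦ]
      refine ciSup_le fun k => Finset.sum_le_sum fun i _ => ?_
      exact mul_le_mul_of_nonneg_left
        (le_ciSup (bddA fun k => dev_bdd hM.le hl (D i) k (S i)) k) (hα i)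
    rw [integral_finsetSum _ fun i _ => hri i] at h1
    have h2 : ∫ S, R S ∂μ = ∑ i, α i * ∫ T, rc l T ∂(Measure.pi fun _ : Fin (m i) => D i) := by
      rw [funext hR, integral_finsetSum _ fun i _ => hci i]
      refine Finset.sum_congr rfl fun i _ => ?_
      rw [integral_const_mul, mp_int (mpe i) (rc_meas hlm)]
    rw [h2, Finset.mul_sum, sub_nonpos]
    refine h1.trans (Finset.sum_le_sum fun i _ => ?_)
    rw [integral_const_mul, mp_int (mpe i) (hrm i)]
    have := mul_le_mul_of_nonneg_left (symm_dev hlm hM.le hl (hm i) (D i)) (hα i)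
    linarith
  -- Lipschitz
  have hsub : LipSubG μ (fun S S' => ∑ i, ∑ j, if S i j = S' i j then 0 else 3 * α i * M / m i)
      (∑ i, ∑ _j : Fin (m i), (3 * α i * M / m i) ^ 2 / 4) := by
    rw [hμ]
    refine LipSubG.pi (fun i => Measure.pi fun _ : Fin (m i) => D i)
      (fun i T T' => ∑ j, if T j = T' j then 0 else 3 * α i * M / m i)
      (fun i => ∑ _j : Fin (m i), (3 * α i * M / m i) ^ 2 / 4) (fun i x => by simp) fun i => ?_
    refine LipSubG.pi (fun _ : Fin (m i) => D i)
      (fun _ z z' => if z = z' then 0 else 3 * α i * M / m i)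
      (fun _ => (3 * α i * M / m i) ^ 2 / 4) (fun i x => by simp) fun j => ?_
    exact LipSubG.base (D i) _ (by have := hα i; positivity)
  have hlip : ∀ S S', (Φ S - 2 * R S) - (Φ S' - 2 * R S') ≤
      ∑ i, ∑ j, if S i j = S' i j then 0 else 3 * α i * M / m i := by
    intro S S'
    have h1 : Φ S - Φ S' ≤ ∑ i, α i * ((1 / (m i : ℝ)) * ∑ j, if S i j = S' i j then 0 else M) := by
      rw [hΦ, hΦ]
      refine sup_sub_le (hφb S') fun k => ?_
      rw [← Finset.sum_sub_distrib]
      refine Finset.sum_le_sum fun i _ => ?_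
      rw [← mul_sub]
      exact mul_le_mul_of_nonneg_left (dev_lip hd (D i) k _ _) (hα i)
    have h2 : R S' - R S ≤ ∑ i, α i * ((1 / (m i : ℝ)) * ∑ j, if S i j = S' i j then 0 else M) := by
      rw [hR, hR, ← Finset.sum_sub_distrib]
      refine Finset.sum_le_sum fun i _ => ?_
      rw [← mul_sub]
      refine mul_le_mul_of_nonneg_left ?_ (hα i)
      have := rc_lip hM.le hl hd (S' i) (S i)
      simpa only [eq_comm] using this
    have h3 : ∑ i, ∑ j, (if S i j = S' i j then 0 else 3 * α i * M / m i) =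
        3 * ∑ i, α i * ((1 / (m i : ℝ)) * ∑ j, if S i j = S' i j then 0 else M) := by
      rw [Finset.mul_sum]
      refine Finset.sum_congr rfl fun i _ => ?_
      rw [← mul_assoc, ← mul_assoc, Finset.mul_sum]
      refine Finset.sum_congr rfl fun j _ => ?_
      split_ifs
      · simp
      · ring
    rw [h3]
    linarith
  have htail := hsub.tail (Finset.sum_nonneg fun i _ => Finset.sum_nonneg fun j _ => by positivity)
    (fun S => Φ S - 2 * R S) hGm hGb hlip ht
  refine le_trans (measureReal_mono fun S hS => ?_) htail
  simp only [Set.mem_ofPred_eq, ← hΦ, ← hR] at hS ⊢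
  linarith

end main

/-- One-sided uniform deviation bound, holding with probability at least `1 - δ/2`. -/
theorem one_sided_uniform_deviation {ι : Type*} [Countable ι] [Nonempty ι]
    (L : Y → Y → ℝ) (hLmeas : Measurable (Function.uncurry L))
    (M : ℝ) (hM : 0 < M) (hL0 : ∀ y y', 0 ≤ L y y') (hLM : ∀ y y', L y y' ≤ M)
    (h : ι → X → Y) (hmeas : ∀ k, Measurable (h k))
    {N : ℕ} (D : Fin N → Measure (X × Y)) [∀ i, IsProbabilityMeasure (D i)]
    (m : Fin N → ℕ) (hm : ∀ i, 1 ≤ m i)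
    (α : Fin N → ℝ) (hα : ∀ i, 0 ≤ α i) (hαs : ∑ i, α i = 1)
    (δ : ℝ) (hδ : 0 < δ) :
    ENNReal.ofReal (1 - δ / 2) ≤
      sampleMeasure m D
        {S | ∀ k : ι,
          (∑ i, α i * expRisk L (D i) (h k)) ≤ empRisk L m α S (h k)
            + 2 * ∑ i, α i * radComplexity L h m S i
            + 3 * Real.sqrt (Real.log (4 / δ) * M ^ 2 / 2)
                * Real.sqrt (∑ i, α i ^ 2 / (m i : ℝ))} := by
  have hlog0 : δ < 2 → 0 < Real.log (4 / δ) := fun h2 =>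
    Real.log_pos (by rw [lt_div_iff₀ hδ]; linarith)
  rcases le_or_gt 2 δ with h2 | h2
  · rw [ENNReal.ofReal_of_nonpos (by linarith)]; exact zero_le
  have hlog := hlog0 h2
  set l : ι → X × Y → ℝ := fun k z => L (h k z.1) z.2 with hl
  have hlm : ∀ k, Measurable (l k) := fun k =>
    hLmeas.comp (((hmeas k).comp measurable_fst).prodMk measurable_snd)
  set V := ∑ i, α i ^ 2 / (m i : ℝ) with hV
  have hm0 : ∀ i, (0 : ℝ) < m i := fun i => by exact_mod_cast hm i
  have hV0 : 0 < V := by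
    have hn : ∀ i ∈ Finset.univ, 0 ≤ α i ^ 2 / (m i : ℝ) := fun i _ => by positivity
    refine lt_of_le_of_ne (Finset.sum_nonneg hn) fun h0 => ?_
    have h1 := (Finset.sum_eq_zero_iff_of_nonneg hn).mp h0.symm
    have h3 : ∀ i, α i = 0 := fun i => by
      have := h1 i (Finset.mem_univ i)
      rw [div_eq_zero_iff] at this
      rcases this with h | h
      · exact pow_eq_zero_iff (by norm_num) |>.mp h
      · exact absurd h (hm0 i).ne'
    simp [h3] at hαs
  set t := 3 * Real.sqrt (Real.log (4 / δ) * M ^ 2 / 2) * Real.sqrt V with ht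
  have ht0 : 0 ≤ t := by positivity
  have ht2 : t ^ 2 = 9 * (Real.log (4 / δ) * M ^ 2 / 2) * V := by
    rw [ht, mul_pow, mul_pow, Real.sq_sqrt (by positivity), Real.sq_sqrt hV0.le]; norm_num
  have instμ : IsProbabilityMeasure (sampleMeasure m D) := by
    unfold sampleMeasure; infer_instance
  have hc := core hlm hM (fun k z => hL0 _ _) (fun k z => hLM _ _) D m hm α hα hαs
    (sampleMeasure m D) rfl t ht0
  have hv : ∑ i, ∑ _j : Fin (m i), (3 * α i * M / m i) ^ 2 / 4 = 9 * M ^ 2 / 4 * V := by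
    rw [hV, Finset.mul_sum]
    refine Finset.sum_congr rfl fun i _ => ?_
    have := hm0 i
    simp
    field_simp
    ring
  have hexp : -t ^ 2 / (2 * (9 * M ^ 2 / 4 * V)) = - Real.log (4 / δ) := by
    rw [ht2]; field_simp; norm_num
  rw [hv, hexp, Real.exp_neg, Real.exp_log (by positivity), inv_div] at hc
  set bad := {S : (i : Fin N) → Fin (m i) → X × Y | t ≤ (⨆ k, ∑ i, α i * dev l (D i) k (S i)) - 2 * ∑ i, α i * rc l (S i)} with hbad
  set good := {S | ∀ k : ι,
          (∑ i, α i * expRisk L (D i) (h k)) ≤ empRisk L m α S (h k)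
            + 2 * ∑ i, α i * radComplexity L h m S i + t} with hgood
  have hsub : badᶜ ⊆ good := by
    intro S hS k
    simp only [hbad, Set.mem_compl_iff, Set.mem_ofPred_eq, not_le] at hS
    have hb : BddAbove (Set.range fun k => ∑ i, α i * dev l (D i) k (S i)) :=
      bddA fun k => wsum_le hα hαs fun i => dev_bdd hM.le (fun k z => by
        rw [abs_of_nonneg (hL0 _ _)]; exact hLM _ _) (D i) k (S i)
    have h1 := le_ciSup hb k
    have h3 : ∑ i, α i * dev l (D i) k (S i) =
        (∑ i, α i * expRisk L (D i) (h k)) - empRisk L m α S (h k) := by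
      unfold empRisk expRisk dev
      rw [← Finset.sum_sub_distrib]
      refine Finset.sum_congr rfl fun i _ => ?_
      rw [hl]
      ring
    simp only [radComplexity_eq, ← hl]
    simp only [h3] at h1
    linarith
  have hu : (1 : ℝ) ≤ (sampleMeasure m D).real badᶜ + (sampleMeasure m D).real bad := by
    have := measureReal_union_le (μ := sampleMeasure m D) badᶜ bad
    rwa [Set.compl_union_self, probReal_univ] at this
  have hg : 1 - δ / 2 ≤ (sampleMeasure m D).real good := by
    have := measureReal_mono (μ := sampleMeasure m D) hsub
    linarith
  exact ENNReal.ofReal_le_of_le_toReal hg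

end
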